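/- arXiv:2511.10918 — 2 statements merged into one kernel-verified Lean document; each statement's English description precedes it below -/
import Mathlib

section
/- Let φ : M × Σ → ℝ be a Hörmander-type phase function (conditions (H1) and (H2)) satisfying Bourgain's condition, and fix a base point (x₀,ξ₀) ∈ M × Σ. Then there exist connected open sets M′ ⊆ M containing x₀ and Σ′ ⊆ Σ containing ξ₀ such that, setting 𝒱′ = ∇_ξφ(M′ × Σ′), there exist a smooth function c : M′ × Σ′ → ℝ and two smooth symmetric-matrix-valued functions A, B : 𝒱′ × Σ′ → Sym_{n−1}(ℝ) with: (i) ∇_ξ²φ(x,ξ) = A(∇_ξφ(x,ξ), ξ) + c(x,ξ)·B(∇_ξφ(x,ξ), ξ) for all (x,ξ) ∈ M′ × Σ′; (ii) B(v,ξ) is nondegenerate for every (v,ξ) ∈ 𝒱′ × Σ′; and (iii) (G(x,ξ)·∇_x)c(x,ξ) ≠ 0 for all (x,ξ) ∈ M′ × Σ′. Moreover, if φ satisfies (H2+), then B(v,ξ) is positive definite for every (v,ξ) ∈ 𝒱′ × Σ′. -/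
open Metric Set Topology MeasureTheory

noncomputable section

/-- ξ-gradient ∇_ξφ(x,ξ). -/
def gradXi (n : ℕ) (φ : (Fin n → ℝ) → (Fin (n-1) → ℝ) → ℝ)
    (x : Fin n → ℝ) (ξ : Fin (n-1) → ℝ) : Fin (n-1) → ℝ :=
  fun j => fderiv ℝ (φ x) ξ (Pi.single j (1:ℝ))

/-- ξ-Hessian ∇_ξ²φ(x,ξ). -/
def hessXi (n : ℕ) (φ : (Fin n → ℝ) → (Fin (n-1) → ℝ) → ℝ)
    (x : Fin n → ℝ) (ξ : Fin (n-1) → ℝ) : Matrix (Fin (n-1)) (Fin (n-1)) ℝ :=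
  Matrix.of fun i j => fderiv ℝ (fun η => gradXi n φ x η i) ξ (Pi.single j (1:ℝ))

/-- Mixed Hessian ∇_x∇_ξφ(x,ξ) : entry (i,j) is ∂_{x_i}∂_{ξ_j}φ. -/
def mixedHess (n : ℕ) (φ : (Fin n → ℝ) → (Fin (n-1) → ℝ) → ℝ)
    (x : Fin n → ℝ) (ξ : Fin (n-1) → ℝ) : Matrix (Fin n) (Fin (n-1)) ℝ :=
  Matrix.of fun i j => fderiv ℝ (fun y => gradXi n φ y ξ j) x (Pi.single i (1:ℝ))

/-- Gauss map: G(x,ξ)ᵢ = det(∂_{ξ_1}∇_xφ, …, ∂_{ξ_{n-1}}∇_xφ, eᵢ), so that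
⟨G(x,ξ), w⟩ = det(∂_{ξ_1}∇_xφ, …, ∂_{ξ_{n-1}}∇_xφ, w) for all w. -/
def gaussMap (n : ℕ) (φ : (Fin n → ℝ) → (Fin (n-1) → ℝ) → ℝ)
    (x : Fin n → ℝ) (ξ : Fin (n-1) → ℝ) : Fin n → ℝ :=
  fun i => Matrix.det (Matrix.of fun a b : Fin n =>
    if h : (b : ℕ) < n - 1 then mixedHess n φ x ξ a ⟨(b : ℕ), h⟩
    else (Pi.single i (1:ℝ) : Fin n → ℝ) a)

/-- Directional derivative (G(x,ξ)·∇_x) f at x. -/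
def GD (n : ℕ) (φ : (Fin n → ℝ) → (Fin (n-1) → ℝ) → ℝ)
    (f : (Fin n → ℝ) → ℝ) (ξ : Fin (n-1) → ℝ) (x : Fin n → ℝ) : ℝ :=
  fderiv ℝ f x (gaussMap n φ x ξ)

/-- The matrix (G(x,ξ)·∇_x)∇_ξ²φ(x,ξ). -/
def GDhess (n : ℕ) (φ : (Fin n → ℝ) → (Fin (n-1) → ℝ) → ℝ)
    (x : Fin n → ℝ) (ξ : Fin (n-1) → ℝ) : Matrix (Fin (n-1)) (Fin (n-1)) ℝ :=
  Matrix.of fun i j => GD n φ (fun y => hessXi n φ y ξ i j) ξ x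

/-- The matrix (G(x,ξ)·∇_x)²∇_ξ²φ(x,ξ). -/
def GD2hess (n : ℕ) (φ : (Fin n → ℝ) → (Fin (n-1) → ℝ) → ℝ)
    (x : Fin n → ℝ) (ξ : Fin (n-1) → ℝ) : Matrix (Fin (n-1)) (Fin (n-1)) ℝ :=
  Matrix.of fun i j => GD n φ (fun y => GD n φ (fun z => hessXi n φ z ξ i j) ξ y) ξ x

/-- Bourgain's condition on M × Σ. -/
def BourgainCond (n : ℕ) (φ : (Fin n → ℝ) → (Fin (n-1) → ℝ) → ℝ)
    (M : Set (Fin n → ℝ)) (Ω : Set (Fin (n-1) → ℝ)) : Prop :=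
  ∃ lam : (Fin n → ℝ) → (Fin (n-1) → ℝ) → ℝ,
    ∀ x ∈ M, ∀ ξ ∈ Ω, GD2hess n φ x ξ = lam x ξ • GDhess n φ x ξ

/-- Hörmander-type phase function: smooth, (H1) and (H2) on M × Σ. -/
def IsHormander (n : ℕ) (φ : (Fin n → ℝ) → (Fin (n-1) → ℝ) → ℝ)
    (M : Set (Fin n → ℝ)) (Ω : Set (Fin (n-1) → ℝ)) : Prop :=
  ContDiffOn ℝ (⊤ : ℕ∞) (fun q : (Fin n → ℝ) × (Fin (n-1) → ℝ) => φ q.1 q.2) (M ×ˢ Ω) ∧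
  (∀ x ∈ M, ∀ ξ ∈ Ω, (mixedHess n φ x ξ).rank = n - 1) ∧
  (∀ x ∈ M, ∀ ξ ∈ Ω, (GDhess n φ x ξ).det ≠ 0)

/-- The point (x̄, t) ∈ ℝⁿ. -/
def toPt (n : ℕ) (xb : Fin (n-1) → ℝ) (t : ℝ) : Fin n → ℝ :=
  fun i => if h : (i : ℕ) < n - 1 then xb ⟨(i : ℕ), h⟩ else t

/-- line_{ξ,v} = {(v,0) − s(ξ,1) : s ∈ ℝ} ⊆ ℝⁿ. -/
def lineSet (n : ℕ) (ξ v : Fin (n-1) → ℝ) : Set (Fin n → ℝ) :=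
  {p | ∃ s : ℝ, p = toPt n v 0 - s • toPt n ξ 1}

end

/-- Inverse function theorem with parameters: if `w ↦ (D_x u · w, ℓ w)` is injective on `S`, then
`(x, ξ) ↦ ((u x ξ, ℓ x), ξ)` has a smooth local inverse near any point of `S`. -/
theorem exists_fiber_parametrization {E W : Type*}
    [NormedAddCommGroup E] [NormedSpace ℝ E] [FiniteDimensional ℝ E]
    [NormedAddCommGroup W] [NormedSpace ℝ W] [FiniteDimensional ℝ W]
    (u : E → W → W) (ℓ : E →L[ℝ] ℝ) (S : Set (E × W)) (hS : IsOpen S)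
    (hu : ∀ p ∈ S, ContDiffAt ℝ (⊤ : ℕ∞) (fun q : E × W => u q.1 q.2) p)
    (hdim : Module.finrank ℝ E = Module.finrank ℝ W + 1)
    (hinj : ∀ p ∈ S, ∀ w, fderiv ℝ (fun y => u y p.2) p.1 w = 0 → ℓ w = 0 → w = 0)
    (p₀ : E × W) (hp₀ : p₀ ∈ S) :
    ∃ (Z : (W × ℝ) × W → E) (V : Set W) (T : Set ℝ) (Ω : Set W),
      IsOpen V ∧ IsOpen T ∧ IsPreconnected T ∧ IsOpen Ω ∧
      u p₀.1 p₀.2 ∈ V ∧ ℓ p₀.1 ∈ T ∧ p₀.2 ∈ Ω ∧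
      (∀ v ∈ V, ∀ t ∈ T, ∀ ξ ∈ Ω, (Z ((v, t), ξ), ξ) ∈ S ∧
        ContDiffAt ℝ (⊤ : ℕ∞) Z ((v, t), ξ) ∧ u (Z ((v, t), ξ)) ξ = v) ∧
      ∀ᶠ q : E × W in 𝓝 p₀, Z ((u q.1 q.2, ℓ q.1), q.2) = q.1 := by
  set Ψ : E × W → (W × ℝ) × W := fun q => ((u q.1 q.2, ℓ q.1), q.2) with hΨ
  have hΨs : ∀ p ∈ S, ContDiffAt ℝ (⊤ : ℕ∞) Ψ p := fun p hp =>
    ((hu p hp).prodMk (ℓ.contDiff.contDiffAt.comp p contDiffAt_fst)).prodMk contDiffAt_snd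
  have hder : ∀ p ∈ S, ∃ e : (E × W) ≃L[ℝ] ((W × ℝ) × W),
      HasFDerivAt Ψ (e : (E × W) →L[ℝ] ((W × ℝ) × W)) p := by
    intro p hp
    have hU := ((hu p hp).differentiableAt (by simp)).hasFDerivAt
    set D := fderiv ℝ (fun q : E × W => u q.1 q.2) p
    have hL : HasFDerivAt Ψ ((D.prod (ℓ.comp (ContinuousLinearMap.fst ℝ E W))).prod
        (ContinuousLinearMap.snd ℝ E W)) p :=
      (hU.prodMk (ℓ.hasFDerivAt.comp p hasFDerivAt_fst)).prodMk hasFDerivAt_snd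
    set L := (D.prod (ℓ.comp (ContinuousLinearMap.fst ℝ E W))).prod
        (ContinuousLinearMap.snd ℝ E W) with hLdef
    have hslice : ∀ w, fderiv ℝ (fun y => u y p.2) p.1 w = D (w, 0) := by
      intro w
      have h1 : HasFDerivAt (fun y : E => (y, p.2)) (ContinuousLinearMap.inl ℝ E W) p.1 :=
        hasFDerivAt_prodMk_left p.1 p.2
      have h2 : HasFDerivAt (fun y => u y p.2) (D.comp (ContinuousLinearMap.inl ℝ E W)) p.1 :=
        HasFDerivAt.comp (g := fun q : E × W => u q.1 q.2) p.1 hU h1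
      rw [h2.fderiv]
      simp
    have hLinj : Function.Injective (L : (E × W) →ₗ[ℝ] ((W × ℝ) × W)) := by
      rw [injective_iff_map_eq_zero]
      rintro ⟨w, η⟩ h
      simp only [hLdef, ContinuousLinearMap.coe_coe, ContinuousLinearMap.prod_apply,
        ContinuousLinearMap.comp_apply, ContinuousLinearMap.coe_fst',
        ContinuousLinearMap.coe_snd', Prod.mk_eq_zero] at h
      obtain ⟨⟨h1, h2⟩, rfl⟩ := h
      rw [hinj p hp w ((hslice w).trans h1) h2]
      rfl
    have hd : Module.finrank ℝ (E × W) = Module.finrank ℝ ((W × ℝ) × W) := by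
      simp [Module.finrank_prod, hdim]
    refine ⟨((L : (E × W) →ₗ[ℝ] ((W × ℝ) × W)).linearEquivOfInjective
      hLinj hd).toContinuousLinearEquiv, ?_⟩
    convert hL using 1
    exact ContinuousLinearMap.ext fun _ => rfl
  obtain ⟨e₀, he₀⟩ := hder p₀ hp₀
  set Φ := (hΨs p₀ hp₀).toOpenPartialHomeomorph Ψ he₀ (by simp)
  have hsrc : p₀ ∈ Φ.source :=
    (hΨs p₀ hp₀).mem_toOpenPartialHomeomorph_source he₀ (by simp)
  have htgt : Φ.target ∩ Φ.symm ⁻¹' S ∈ 𝓝 (Ψ p₀) := by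
    refine (Φ.isOpen_inter_preimage_symm hS).mem_nhds ⟨?_, ?_⟩
    · exact Φ.map_source hsrc
    · change Φ.symm (Φ p₀) ∈ S
      rwa [Φ.left_inv hsrc]
  obtain ⟨r, hr, hball⟩ := Metric.mem_nhds_iff.1 htgt
  refine ⟨fun y => (Φ.symm y).1, ball (u p₀.1 p₀.2) r, ball (ℓ p₀.1) r, ball p₀.2 r,
    isOpen_ball, isOpen_ball, (convex_ball _ _).isPreconnected, isOpen_ball,
    mem_ball_self hr, mem_ball_self hr, mem_ball_self hr, ?_, ?_⟩
  · intro v hv t ht ξ hξ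
    have hmem : ((v, t), ξ) ∈ ball (Ψ p₀) r := by
      rw [hΨ, ← ball_prod_same, ← ball_prod_same]
      exact ⟨⟨hv, ht⟩, hξ⟩
    obtain ⟨h1, h2⟩ := hball hmem
    have hri : Ψ (Φ.symm ((v, t), ξ)) = ((v, t), ξ) := Φ.right_inv h1
    simp only [hΨ, Prod.mk.injEq] at hri
    obtain ⟨⟨hv', -⟩, hξ'⟩ := hri
    have heta : ((Φ.symm ((v, t), ξ)).1, ξ) = Φ.symm ((v, t), ξ) := Prod.ext rfl hξ'.symm
    obtain ⟨e, he⟩ := hder _ h2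
    refine ⟨by rw [heta]; exact h2, ?_, ?_⟩
    · exact contDiffAt_fst.comp _ (Φ.contDiffAt_symm h1 he (hΨs _ h2))
    · rw [hξ'] at hv'
      exact hv'
  · filter_upwards [Φ.open_source.mem_nhds hsrc] with q hq
    exact congrArg Prod.fst (Φ.left_inv hq)

section Smoothness

variable {n : ℕ} {φ : (Fin n → ℝ) → (Fin (n-1) → ℝ) → ℝ}
  {M : Set (Fin n → ℝ)} {Ω : Set (Fin (n-1) → ℝ)}

/-- Joint smoothness of a two-variable function at each point of a product set. -/
def SmoothOnProd {E W F : Type*} [NormedAddCommGroup E] [NormedSpace ℝ E]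
    [NormedAddCommGroup W] [NormedSpace ℝ W] [NormedAddCommGroup F] [NormedSpace ℝ F]
    (f : E → W → F) (M : Set E) (Ω : Set W) : Prop :=
  ∀ x ∈ M, ∀ ξ ∈ Ω, ContDiffAt ℝ (⊤ : ℕ∞) (fun q : E × W => f q.1 q.2) (x, ξ)

namespace SmoothOnProd

variable {E W F : Type*} [NormedAddCommGroup E] [NormedSpace ℝ E]
    [NormedAddCommGroup W] [NormedSpace ℝ W] [NormedAddCommGroup F] [NormedSpace ℝ F]
    {f : E → W → F} {M : Set E} {Ω : Set W}

theorem fderiv_right (hf : SmoothOnProd f M Ω) :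
    SmoothOnProd (fun x ξ => fderiv ℝ (f x) ξ) M Ω := by
  intro x hx ξ hξ
  refine ContDiffAt.fderiv (n := (⊤ : ℕ∞)) (f := fun q : E × W => f q.1) (g := Prod.snd) ?_
    contDiffAt_snd (by simp)
  exact (hf x hx ξ hξ).comp ((x, ξ), ξ)
    (g := fun q : E × W => f q.1 q.2) (f := fun z : (E × W) × W => (z.1.1, z.2)) (by fun_prop)

theorem fderiv_left (hf : SmoothOnProd f M Ω) :
    SmoothOnProd (fun x ξ => fderiv ℝ (fun y => f y ξ) x) M Ω := by
  intro x hx ξ hξ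
  refine ContDiffAt.fderiv (n := (⊤ : ℕ∞)) (f := fun (q : E × W) y => f y q.2) (g := Prod.fst) ?_
    contDiffAt_fst (by simp)
  exact (hf x hx ξ hξ).comp ((x, ξ), x)
    (g := fun q : E × W => f q.1 q.2) (f := fun z : (E × W) × E => (z.2, z.1.2)) (by fun_prop)

theorem contDiffAt_left (hf : SmoothOnProd f M Ω) {x : E} (hx : x ∈ M) {ξ : W} (hξ : ξ ∈ Ω) :
    ContDiffAt ℝ (⊤ : ℕ∞) (fun y => f y ξ) x :=
  (hf x hx ξ hξ).comp x (g := fun q : E × W => f q.1 q.2) (f := fun y => (y, ξ)) (by fun_prop)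

theorem contDiffAt_right (hf : SmoothOnProd f M Ω) {x : E} (hx : x ∈ M) {ξ : W} (hξ : ξ ∈ Ω) :
    ContDiffAt ℝ (⊤ : ℕ∞) (f x) ξ :=
  (hf x hx ξ hξ).comp ξ (g := fun q : E × W => f q.1 q.2) (f := fun η => (x, η)) (by fun_prop)

theorem differentiableAt_left (hf : SmoothOnProd f M Ω) {x : E} (hx : x ∈ M)
    {ξ : W} (hξ : ξ ∈ Ω) : DifferentiableAt ℝ (fun y => f y ξ) x :=
  (hf.contDiffAt_left hx hξ).differentiableAt (by simp)

end SmoothOnProd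

theorem smoothOnProd_gradXi_apply (hφ : SmoothOnProd φ M Ω) (j : Fin (n-1)) :
    SmoothOnProd (fun x ξ => gradXi n φ x ξ j) M Ω := fun x hx ξ hξ =>
  (hφ.fderiv_right x hx ξ hξ).clm_apply contDiffAt_const

theorem smoothOnProd_gradXi (hφ : SmoothOnProd φ M Ω) : SmoothOnProd (gradXi n φ) M Ω :=
  fun x hx ξ hξ => contDiffAt_pi.2 fun j => smoothOnProd_gradXi_apply hφ j x hx ξ hξ

theorem smoothOnProd_hessXi (hφ : SmoothOnProd φ M Ω) (i j : Fin (n-1)) :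
    SmoothOnProd (fun x ξ => hessXi n φ x ξ i j) M Ω := fun x hx ξ hξ =>
  ((smoothOnProd_gradXi_apply hφ i).fderiv_right x hx ξ hξ).clm_apply contDiffAt_const

theorem smoothOnProd_mixedHess (hφ : SmoothOnProd φ M Ω) (i : Fin n) (j : Fin (n-1)) :
    SmoothOnProd (fun x ξ => mixedHess n φ x ξ i j) M Ω := fun x hx ξ hξ =>
  ((smoothOnProd_gradXi_apply hφ j).fderiv_left x hx ξ hξ).clm_apply contDiffAt_const

theorem smoothOnProd_gaussMap (hφ : SmoothOnProd φ M Ω) :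
    SmoothOnProd (gaussMap n φ) M Ω := by
  intro x hx ξ hξ
  refine contDiffAt_pi.2 fun i => ?_
  simp only [gaussMap, Matrix.det_apply, Matrix.of_apply]
  refine ContDiffAt.sum fun σ _ => ContDiffAt.const_smul _ (contDiffAt_prod fun b _ => ?_)
  split_ifs with h
  · exact smoothOnProd_mixedHess hφ _ _ x hx ξ hξ
  · exact contDiffAt_const

theorem smoothOnProd_GDhess (hφ : SmoothOnProd φ M Ω) (i j : Fin (n-1)) :
    SmoothOnProd (fun x ξ => GDhess n φ x ξ i j) M Ω := fun x hx ξ hξ =>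
  ((smoothOnProd_hessXi hφ i j).fderiv_left x hx ξ hξ).clm_apply
    (smoothOnProd_gaussMap hφ x hx ξ hξ)

theorem hessXi_isSymm (hφ : SmoothOnProd φ M Ω) {x : Fin n → ℝ} (hx : x ∈ M)
    {ξ : Fin (n-1) → ℝ} (hξ : ξ ∈ Ω) : (hessXi n φ x ξ).IsSymm := by
  have h2 := hφ.contDiffAt_right hx hξ
  have hd : DifferentiableAt ℝ (fderiv ℝ (φ x)) ξ :=
    (hφ.fderiv_right.contDiffAt_right hx hξ).differentiableAt (by simp)
  have key : ∀ i j, hessXi n φ x ξ i j =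
      fderiv ℝ (fderiv ℝ (φ x)) ξ (Pi.single j 1) (Pi.single i 1) := by
    intro i j
    simp only [hessXi, gradXi, Matrix.of_apply]
    rw [fderiv_clm_apply hd (differentiableAt_const _)]
    simp
  ext i j
  rw [Matrix.transpose_apply, key, key]
  have hle : minSmoothness ℝ 2 ≤ ((⊤ : ℕ∞) : WithTop ℕ∞) := by
    rw [minSmoothness_of_isRCLikeNormedField]
    exact WithTop.coe_le_coe.2 le_top
  exact (h2.isSymmSndFDerivAt hle) _ _

theorem GDhess_isSymm (hM : IsOpen M) (hφ : SmoothOnProd φ M Ω)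
    {x : Fin n → ℝ} (hx : x ∈ M) {ξ : Fin (n-1) → ℝ} (hξ : ξ ∈ Ω) :
    (GDhess n φ x ξ).IsSymm := by
  ext i j
  simp only [Matrix.transpose_apply, GDhess, Matrix.of_apply, GD]
  congr 1
  refine Filter.EventuallyEq.fderiv_eq ?_
  filter_upwards [hM.mem_nhds hx] with y hy
  exact (hessXi_isSymm hφ hy hξ).apply i j

end Smoothness

section GaussMap

variable {n : ℕ} {φ : (Fin n → ℝ) → (Fin (n-1) → ℝ) → ℝ}
  {x : Fin n → ℝ} {ξ : Fin (n-1) → ℝ}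

theorem mixedHess_transpose_mulVec_gaussMap (hn : 2 ≤ n) :
    (mixedHess n φ x ξ).transpose.mulVec (gaussMap n φ x ξ) = 0 := by
  set N : Matrix (Fin n) (Fin n) ℝ := Matrix.of fun a b =>
    if h : (b : ℕ) < n - 1 then mixedHess n φ x ξ a ⟨b, h⟩ else 0 with hN
  set last : Fin n := ⟨n - 1, by omega⟩ with hlast
  have hG : ∀ i, gaussMap n φ x ξ i = N.cramer (Pi.single i 1) last := by
    intro i
    rw [Matrix.cramer_apply, gaussMap]
    congr 1
    ext a b
    by_cases hb : (b : ℕ) < n - 1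
    · have : b ≠ last := by rintro rfl; simp [hlast] at hb
      simp [this, hN, hb]
    · have : b = last := by ext; simp [hlast]; omega
      simp [this, hlast]
  ext k
  have hk : (k : ℕ) < n := by omega
  have hcol : ∀ a, mixedHess n φ x ξ a k = N a ⟨k, hk⟩ := by
    intro a
    simp [hN]
  have hne : last ≠ ⟨k, hk⟩ := by
    intro h
    have := congrArg Fin.val h
    simp only [hlast] at this
    omega
  simp only [Matrix.mulVec, dotProduct, Matrix.transpose_apply, Pi.zero_apply]
  have : ∀ a, mixedHess n φ x ξ a k * gaussMap n φ x ξ a = N.adjugate last a * N a ⟨k, hk⟩ := by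
    intro a
    rw [hcol, hG, Matrix.cramer_eq_adjugate_mulVec, Matrix.mulVec_single_one, mul_comm]
    rfl
  rw [Finset.sum_congr rfl fun a _ => this a, ← Matrix.mul_apply, Matrix.adjugate_mul]
  simp [Matrix.one_apply_ne hne]

theorem fderiv_gradXi_apply (hd : DifferentiableAt ℝ (fun y => gradXi n φ y ξ) x)
    (w : Fin n → ℝ) :
    fderiv ℝ (fun y => gradXi n φ y ξ) x w = (mixedHess n φ x ξ).transpose.mulVec w := by
  have hw : w = ∑ i, w i • (Pi.single i (1 : ℝ) : Fin n → ℝ) := (pi_eq_sum_univ' w)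
  ext k
  have h1 : fderiv ℝ (fun y => gradXi n φ y ξ) x w k
      = fderiv ℝ (fun y => gradXi n φ y ξ k) x w := by
    rw [(hasFDerivAt_pi'.1 hd.hasFDerivAt k).fderiv]
    rfl
  rw [h1]
  conv_lhs => rw [hw]
  simp only [map_sum, map_smul, Matrix.mulVec, dotProduct, Matrix.transpose_apply, mixedHess,
    Matrix.of_apply, smul_eq_mul]
  exact Finset.sum_congr rfl fun i _ => mul_comm _ _

theorem gaussMap_ne_zero (hn : 2 ≤ n) (h : (GDhess n φ x ξ).det ≠ 0) : gaussMap n φ x ξ ≠ 0 := by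
  intro h0
  have hzero : GDhess n φ x ξ = 0 := by
    ext i j
    simp [GDhess, GD, h0]
  have : Nonempty (Fin (n-1)) := ⟨⟨0, by omega⟩⟩
  exact h (by rw [hzero, Matrix.det_zero])

theorem exists_smul_gaussMap_eq (hn : 2 ≤ n) (hrank : (mixedHess n φ x ξ).rank = n - 1)
    (hdet : (GDhess n φ x ξ).det ≠ 0) {w : Fin n → ℝ}
    (hw : (mixedHess n φ x ξ).transpose.mulVec w = 0) : ∃ s : ℝ, s • gaussMap n φ x ξ = w := by
  set L := (mixedHess n φ x ξ).transpose.mulVecLin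
  have hr : Module.finrank ℝ (LinearMap.range L) = n - 1 := by
    rw [← Matrix.rank_transpose] at hrank
    exact hrank
  have hk : Module.finrank ℝ (LinearMap.ker L) = 1 := by
    have := L.finrank_range_add_finrank_ker
    simp only [Module.finrank_fintype_fun_eq_card, Fintype.card_fin] at this
    omega
  let G : LinearMap.ker L := ⟨gaussMap n φ x ξ, mixedHess_transpose_mulVec_gaussMap hn⟩
  have hG : G ≠ 0 := fun h => gaussMap_ne_zero hn hdet (congrArg Subtype.val h)
  obtain ⟨s, hs⟩ := (finrank_eq_one_iff_of_nonzero' G hG).1 hk ⟨w, hw⟩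
  exact ⟨s, congrArg Subtype.val hs⟩

end GaussMap

theorem fderiv_fun_div_apply {E : Type*} [NormedAddCommGroup E] [NormedSpace ℝ E] {f g : E → ℝ}
    {x : E} (hf : DifferentiableAt ℝ f x) (hg : DifferentiableAt ℝ g x) (hx : g x ≠ 0) (w : E) :
    fderiv ℝ (fun y => f y / g y) x w
      = (fderiv ℝ f x w * g x - f x * fderiv ℝ g x w) / g x ^ 2 := by
  have h := hf.hasFDerivAt.mul ((hasDerivAt_inv hx).comp_hasFDerivAt x hg.hasFDerivAt)
  have h' : HasFDerivAt (fun y => f y / g y) _ x := h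
  rw [h'.fderiv]
  simp only [Function.comp_apply, add_apply, smul_apply,
    smul_eq_mul]
  field_simp
  ring

theorem eq_of_fderiv_deriv_eq_zero {E : Type*} [NormedAddCommGroup E] [NormedSpace ℝ E]
    {f : E → ℝ} {y : ℝ → E} {T : Set ℝ} (hT : IsOpen T) (hTc : IsPreconnected T)
    (hy : ∀ t ∈ T, DifferentiableAt ℝ y t) (hf : ∀ t ∈ T, DifferentiableAt ℝ f (y t))
    (h0 : ∀ t ∈ T, fderiv ℝ f (y t) (deriv y t) = 0) {t r : ℝ} (ht : t ∈ T) (hr : r ∈ T) :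
    f (y t) = f (y r) := by
  have hd : ∀ s ∈ T, HasDerivAt (fun s => f (y s)) 0 s := by
    intro s hs
    rw [← h0 s hs]
    exact (hf s hs).hasFDerivAt.comp_hasDerivAt s (hy s hs).hasDerivAt
  exact hT.is_const_of_deriv_eq_zero hTc
    (fun s hs => (hd s hs).differentiableAt.differentiableWithinAt)
    (fun s hs => (hd s hs).deriv) ht hr

/-- Along a curve moving in the Gauss direction, Bourgain's condition keeps the ray spanned by
`(G·∇_x)∇_ξ²φ` fixed, and hence the increments of `∇_ξ²φ` stay on that ray. -/
theorem hessXi_sub_eq_of_curve {n : ℕ} {φ : (Fin n → ℝ) → (Fin (n-1) → ℝ) → ℝ}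
    {M : Set (Fin n → ℝ)} {Ω : Set (Fin (n-1) → ℝ)} (hφ : SmoothOnProd φ M Ω)
    (hB : BourgainCond n φ M Ω) {ξ : Fin (n-1) → ℝ} (hξ : ξ ∈ Ω) (a b : Fin (n-1))
    {y : ℝ → Fin n → ℝ} {T : Set ℝ} (hT : IsOpen T) (hTc : IsPreconnected T)
    (hy : ∀ t ∈ T, DifferentiableAt ℝ y t) (hM : ∀ t ∈ T, y t ∈ M)
    (hab : ∀ t ∈ T, GDhess n φ (y t) ξ a b ≠ 0)
    (hG : ∀ t ∈ T, ∃ s : ℝ, s • gaussMap n φ (y t) ξ = deriv y t)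
    {t t' : ℝ} (ht : t ∈ T) (ht' : t' ∈ T) :
    hessXi n φ (y t) ξ - hessXi n φ (y t') ξ =
      ((hessXi n φ (y t) ξ a b - hessXi n φ (y t') ξ a b) / GDhess n φ (y t') ξ a b) •
        GDhess n φ (y t') ξ := by
  obtain ⟨lam, hlam⟩ := hB
  have hconst : ∀ f : (Fin n → ℝ) → ℝ, (∀ s ∈ T, DifferentiableAt ℝ f (y s)) →
      (∀ s ∈ T, GD n φ f ξ (y s) = 0) → ∀ s ∈ T, f (y s) = f (y t') := by
    intro f hf h0 s hs
    refine eq_of_fderiv_deriv_eq_zero hT hTc hy hf (fun r hr => ?_) hs ht'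
    obtain ⟨k, hk⟩ := hG r hr
    rw [← hk, map_smul]
    exact smul_eq_zero_of_right _ (h0 r hr)
  have hgd : ∀ i j, ∀ s ∈ T, DifferentiableAt ℝ (fun z => GDhess n φ z ξ i j) (y s) :=
    fun i j s hs => (smoothOnProd_GDhess hφ i j).differentiableAt_left (hM s hs) hξ
  have hhd : ∀ i j, ∀ s ∈ T, DifferentiableAt ℝ (fun z => hessXi n φ z ξ i j) (y s) :=
    fun i j s hs => (smoothOnProd_hessXi hφ i j).differentiableAt_left (hM s hs) hξ
  have hg2 : ∀ i j, ∀ s ∈ T, fderiv ℝ (fun z => GDhess n φ z ξ i j) (y s) (gaussMap n φ (y s) ξ)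
      = lam (y s) ξ * GDhess n φ (y s) ξ i j := fun i j s hs =>
    congrFun (congrFun (hlam (y s) (hM s hs) ξ hξ) i) j
  have hratio : ∀ i j, ∀ s ∈ T, GDhess n φ (y s) ξ i j / GDhess n φ (y s) ξ a b
      = GDhess n φ (y t') ξ i j / GDhess n φ (y t') ξ a b := by
    intro i j
    refine hconst (fun z => GDhess n φ z ξ i j / GDhess n φ z ξ a b)
      (fun s hs => (hgd i j s hs).fun_mul ((hgd a b s hs).fun_inv (hab s hs))) (fun s hs => ?_)
    rw [GD, fderiv_fun_div_apply (hgd i j s hs) (hgd a b s hs) (hab s hs), hg2 i j s hs,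
      hg2 a b s hs]
    ring
  ext i j
  set ρ := GDhess n φ (y t') ξ i j / GDhess n φ (y t') ξ a b with hρ
  have h := hconst (fun z => hessXi n φ z ξ i j - hessXi n φ z ξ a b * ρ)
    (fun s hs => (hhd i j s hs).sub ((hhd a b s hs).mul_const ρ)) (fun s hs => ?_) t ht
  · simp only [Matrix.sub_apply, Matrix.smul_apply, smul_eq_mul]
    have : (hessXi n φ (y t) ξ a b - hessXi n φ (y t') ξ a b) / GDhess n φ (y t') ξ a b
        * GDhess n φ (y t') ξ i j = (hessXi n φ (y t) ξ a b - hessXi n φ (y t') ξ a b) * ρ := by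
      rw [hρ]
      ring
    rw [this]
    linarith
  · have hd := (hhd i j s hs).hasFDerivAt.sub ((hhd a b s hs).hasFDerivAt.mul_const ρ)
    have hd' : HasFDerivAt (fun z => hessXi n φ z ξ i j - hessXi n φ z ξ a b * ρ) _ (y s) := hd
    have hr := hratio i j s hs
    rw [div_eq_iff (hab s hs)] at hr
    rw [GD, hd'.fderiv]
    simp only [sub_apply, smul_apply, smul_eq_mul]
    change GDhess n φ (y s) ξ i j - ρ * GDhess n φ (y s) ξ a b = 0
    rw [hr, sub_self]

theorem stmt1 (n : ℕ) (hn : 2 ≤ n)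
    (M : Set (Fin n → ℝ)) (Ω : Set (Fin (n-1) → ℝ))
    (hMo : IsOpen M) (hMc : IsConnected M) (hΩo : IsOpen Ω) (hΩc : IsConnected Ω)
    (φ : (Fin n → ℝ) → (Fin (n-1) → ℝ) → ℝ)
    (hφ : IsHormander n φ M Ω)
    (hB : BourgainCond n φ M Ω)
    (x₀ : Fin n → ℝ) (hx₀ : x₀ ∈ M) (ξ₀ : Fin (n-1) → ℝ) (hξ₀ : ξ₀ ∈ Ω) :
    ∃ (M' : Set (Fin n → ℝ)) (Ω' : Set (Fin (n-1) → ℝ)),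
      IsOpen M' ∧ IsConnected M' ∧ IsOpen Ω' ∧ IsConnected Ω' ∧
      x₀ ∈ M' ∧ M' ⊆ M ∧ ξ₀ ∈ Ω' ∧ Ω' ⊆ Ω ∧
      ∃ (c : (Fin n → ℝ) → (Fin (n-1) → ℝ) → ℝ)
        (A B : (Fin (n-1) → ℝ) → (Fin (n-1) → ℝ) → Matrix (Fin (n-1)) (Fin (n-1)) ℝ),
        let V' : Set (Fin (n-1) → ℝ) :=
          (fun q : (Fin n → ℝ) × (Fin (n-1) → ℝ) => gradXi n φ q.1 q.2) '' (M' ×ˢ Ω')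
        ContDiffOn ℝ (⊤ : ℕ∞) (fun q : (Fin n → ℝ) × (Fin (n-1) → ℝ) => c q.1 q.2) (M' ×ˢ Ω') ∧
        (∀ i j, ContDiffOn ℝ (⊤ : ℕ∞)
          (fun q : (Fin (n-1) → ℝ) × (Fin (n-1) → ℝ) => A q.1 q.2 i j) (V' ×ˢ Ω')) ∧
        (∀ i j, ContDiffOn ℝ (⊤ : ℕ∞)
          (fun q : (Fin (n-1) → ℝ) × (Fin (n-1) → ℝ) => B q.1 q.2 i j) (V' ×ˢ Ω')) ∧
        (∀ v ξ, (v, ξ) ∈ V' ×ˢ Ω' → (A v ξ).IsSymm ∧ (B v ξ).IsSymm) ∧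
        (∀ x ∈ M', ∀ ξ ∈ Ω',
          hessXi n φ x ξ = A (gradXi n φ x ξ) ξ + c x ξ • B (gradXi n φ x ξ) ξ) ∧
        (∀ v ξ, (v, ξ) ∈ V' ×ˢ Ω' → (B v ξ).det ≠ 0) ∧
        (∀ x ∈ M', ∀ ξ ∈ Ω', GD n φ (fun y => c y ξ) ξ x ≠ 0) ∧
        ((∀ x ∈ M, ∀ ξ ∈ Ω, (GDhess n φ x ξ).PosDef) →
          ∀ v ξ, (v, ξ) ∈ V' ×ˢ Ω' → (B v ξ).PosDef) := by
  obtain ⟨hs, hrank, hdet⟩ := hφ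
  have hsm : SmoothOnProd φ M Ω := fun x hx ξ hξ =>
    hs.contDiffAt ((hMo.prod hΩo).mem_nhds ⟨hx, hξ⟩)
  obtain ⟨i₀, hi₀⟩ := Function.ne_iff.1 (gaussMap_ne_zero hn (hdet x₀ hx₀ ξ₀ hξ₀))
  obtain ⟨a, b, hab⟩ : ∃ a b, GDhess n φ x₀ ξ₀ a b ≠ 0 := by
    by_contra! h
    have : Nonempty (Fin (n-1)) := ⟨⟨0, by omega⟩⟩
    have hz : GDhess n φ x₀ ξ₀ = 0 := by
      ext i j
      exact h i j
    exact hdet x₀ hx₀ ξ₀ hξ₀ (by rw [hz, Matrix.det_zero])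
  set S : Set ((Fin n → ℝ) × (Fin (n-1) → ℝ)) :=
    {q | q ∈ M ×ˢ Ω ∧ gaussMap n φ q.1 q.2 i₀ ≠ 0 ∧ GDhess n φ q.1 q.2 a b ≠ 0}
  have hSo : IsOpen S := by
    refine isOpen_iff_mem_nhds.2 fun q hq => ?_
    obtain ⟨hq, h1, h2⟩ := hq
    have c1 : ContinuousAt (fun q : (Fin n → ℝ) × (Fin (n-1) → ℝ) => gaussMap n φ q.1 q.2 i₀) q :=
      continuousAt_pi.1 (smoothOnProd_gaussMap hsm q.1 hq.1 q.2 hq.2).continuousAt i₀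
    have c2 : ContinuousAt (fun q : (Fin n → ℝ) × (Fin (n-1) → ℝ) => GDhess n φ q.1 q.2 a b) q :=
      (smoothOnProd_GDhess hsm a b q.1 hq.1 q.2 hq.2).continuousAt
    filter_upwards [(hMo.prod hΩo).mem_nhds hq, c1.eventually_ne h1, c2.eventually_ne h2]
      with r hr hr1 hr2 using ⟨hr, hr1, hr2⟩
  have hker : ∀ x ∈ M, ∀ ξ ∈ Ω, ∀ w, fderiv ℝ (fun y => gradXi n φ y ξ) x w = 0 →
      ∃ s : ℝ, s • gaussMap n φ x ξ = w := by
    intro x hx ξ hξ w hw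
    rw [fderiv_gradXi_apply ((smoothOnProd_gradXi hsm).differentiableAt_left hx hξ)] at hw
    exact exists_smul_gaussMap_eq hn (hrank x hx ξ hξ) (hdet x hx ξ hξ) hw
  obtain ⟨Z, V, T, Ω₁, hV, hT, hTc, hΩ₁, hv₀, ht₀, hξ₁, hZ, hinv⟩ :=
    exists_fiber_parametrization (gradXi n φ)
      (ContinuousLinearMap.proj (R := ℝ) (φ := fun _ : Fin n => ℝ) i₀) S hSo
      (fun p hp => smoothOnProd_gradXi hsm p.1 hp.1.1 p.2 hp.1.2)
      (by simp only [Module.finrank_fintype_fun_eq_card, Fintype.card_fin]; omega)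
      (by
        rintro p ⟨hp, hG, -⟩ w hw hℓ
        obtain ⟨s, rfl⟩ := hker p.1 hp.1 p.2 hp.2 w hw
        have : s = 0 := by simpa [hG] using hℓ
        simp [this])
      (x₀, ξ₀) ⟨⟨hx₀, hξ₀⟩, hi₀, hab⟩
  simp only [ContinuousLinearMap.proj_apply] at ht₀ hinv
  set t₀ := x₀ i₀
  have hcg : ContinuousAt (fun q : (Fin n → ℝ) × (Fin (n-1) → ℝ) => gradXi n φ q.1 q.2)
      (x₀, ξ₀) := (smoothOnProd_gradXi hsm x₀ hx₀ ξ₀ hξ₀).continuousAt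
  have hct : ContinuousAt (fun q : (Fin n → ℝ) × (Fin (n-1) → ℝ) => q.1 i₀) (x₀, ξ₀) := by
    fun_prop
  have hcξ : ContinuousAt (fun q : (Fin n → ℝ) × (Fin (n-1) → ℝ) => q.2) (x₀, ξ₀) := by
    fun_prop
  have hbox : ∀ᶠ q : (Fin n → ℝ) × (Fin (n-1) → ℝ) in nhds (x₀, ξ₀), q ∈ S ∧
      gradXi n φ q.1 q.2 ∈ V ∧ q.1 i₀ ∈ T ∧ q.2 ∈ Ω₁ ∧
      Z ((gradXi n φ q.1 q.2, q.1 i₀), q.2) = q.1 := by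
    filter_upwards [hSo.mem_nhds ⟨⟨hx₀, hξ₀⟩, hi₀, hab⟩, hcg (hV.mem_nhds hv₀),
      hct (hT.mem_nhds ht₀), hcξ (hΩ₁.mem_nhds hξ₁), hinv] with q h1 h2 h3 h4 h5
      using ⟨h1, h2, h3, h4, h5⟩
  obtain ⟨r, hr, hball⟩ := Metric.eventually_nhds_iff_ball.1 hbox
  have hin : ∀ x ∈ ball x₀ r, ∀ ξ ∈ ball ξ₀ r, _ := fun x hx ξ hξ =>
    hball (x, ξ) (by rw [← ball_prod_same]; exact ⟨hx, hξ⟩)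
  have hVΩ : ∀ q : (Fin (n-1) → ℝ) × (Fin (n-1) → ℝ),
      q ∈ ((fun q : (Fin n → ℝ) × (Fin (n-1) → ℝ) => gradXi n φ q.1 q.2) ''
        (ball x₀ r ×ˢ ball ξ₀ r)) ×ˢ ball ξ₀ r → q.1 ∈ V ∧ q.2 ∈ Ω₁ := by
    rintro ⟨v, ξ⟩ ⟨⟨p, hp, rfl⟩, hξ⟩
    exact ⟨(hin p.1 hp.1 p.2 hp.2).2.1, (hin x₀ (mem_ball_self hr) ξ hξ).2.2.2.1⟩
  have hsec : ∀ f : (Fin n → ℝ) → (Fin (n-1) → ℝ) → ℝ, SmoothOnProd f M Ω →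
      SmoothOnProd (fun v ξ => f (Z ((v, t₀), ξ)) ξ) V Ω₁ := by
    intro f hf v hv ξ hξ
    obtain ⟨hS, hZs, -⟩ := hZ v hv t₀ ht₀ ξ hξ
    refine (hf _ hS.1.1 _ hS.1.2).comp (v, ξ)
      (g := fun q : (Fin n → ℝ) × (Fin (n-1) → ℝ) => f q.1 q.2)
      (f := fun q : (Fin (n-1) → ℝ) × (Fin (n-1) → ℝ) => (Z ((q.1, t₀), q.2), q.2)) ?_
    refine ContDiffAt.prodMk ?_ contDiffAt_snd
    exact hZs.comp (v, ξ)
      (f := fun q : (Fin (n-1) → ℝ) × (Fin (n-1) → ℝ) => ((q.1, t₀), q.2)) (by fun_prop)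
  set A : (Fin (n-1) → ℝ) → (Fin (n-1) → ℝ) → Matrix (Fin (n-1)) (Fin (n-1)) ℝ :=
    fun v ξ => hessXi n φ (Z ((v, t₀), ξ)) ξ
  set B : (Fin (n-1) → ℝ) → (Fin (n-1) → ℝ) → Matrix (Fin (n-1)) (Fin (n-1)) ℝ :=
    fun v ξ => GDhess n φ (Z ((v, t₀), ξ)) ξ
  have hAs : ∀ i j, SmoothOnProd (fun v ξ => A v ξ i j) V Ω₁ := fun i j =>
    hsec _ (smoothOnProd_hessXi hsm i j)
  have hBs : ∀ i j, SmoothOnProd (fun v ξ => B v ξ i j) V Ω₁ := fun i j =>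
    hsec _ (smoothOnProd_GDhess hsm i j)
  have hBab : ∀ v ∈ V, ∀ ξ ∈ Ω₁, B v ξ a b ≠ 0 := fun v hv ξ hξ => (hZ v hv t₀ ht₀ ξ hξ).1.2.2
  refine ⟨ball x₀ r, ball ξ₀ r, isOpen_ball, ⟨⟨x₀, mem_ball_self hr⟩,
    (convex_ball _ _).isPreconnected⟩, isOpen_ball, ⟨⟨ξ₀, mem_ball_self hr⟩,
    (convex_ball _ _).isPreconnected⟩, mem_ball_self hr,
    fun x hx => (hin x hx ξ₀ (mem_ball_self hr)).1.1.1, mem_ball_self hr,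
    fun ξ hξ => (hin x₀ (mem_ball_self hr) ξ hξ).1.1.2,
    fun x ξ => (hessXi n φ x ξ a b - A (gradXi n φ x ξ) ξ a b) / B (gradXi n φ x ξ) ξ a b,
    A, B, ?_, ?_, ?_, ?_, ?_, ?_, ?_, ?_⟩
  · rintro ⟨x, ξ⟩ ⟨hx, hξ⟩
    obtain ⟨hS, hv, -, hξ', -⟩ := hin x hx ξ hξ
    have hu : ContDiffAt ℝ (⊤ : ℕ∞)
        (fun q : (Fin n → ℝ) × (Fin (n-1) → ℝ) => (gradXi n φ q.1 q.2, q.2)) (x, ξ) :=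
      (smoothOnProd_gradXi hsm x hS.1.1 ξ hS.1.2).prodMk contDiffAt_snd
    have hAu : ContDiffAt ℝ (⊤ : ℕ∞) (fun q : (Fin n → ℝ) × (Fin (n-1) → ℝ) =>
        A (gradXi n φ q.1 q.2) q.2 a b) (x, ξ) :=
      ContDiffAt.comp (g := fun q : (Fin (n-1) → ℝ) × (Fin (n-1) → ℝ) => A q.1 q.2 a b)
        (x, ξ) (hAs a b _ hv ξ hξ') hu
    have hBu : ContDiffAt ℝ (⊤ : ℕ∞) (fun q : (Fin n → ℝ) × (Fin (n-1) → ℝ) =>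
        B (gradXi n φ q.1 q.2) q.2 a b) (x, ξ) :=
      ContDiffAt.comp (g := fun q : (Fin (n-1) → ℝ) × (Fin (n-1) → ℝ) => B q.1 q.2 a b)
        (x, ξ) (hBs a b _ hv ξ hξ') hu
    exact (((smoothOnProd_hessXi hsm a b x hS.1.1 ξ hS.1.2).sub hAu).div hBu
      (hBab _ hv ξ hξ')).contDiffWithinAt
  · exact fun i j q hq =>
      (hAs i j q.1 (hVΩ q hq).1 q.2 (hVΩ q hq).2).contDiffWithinAt
  · exact fun i j q hq =>
      (hBs i j q.1 (hVΩ q hq).1 q.2 (hVΩ q hq).2).contDiffWithinAt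
  · intro v ξ hq
    obtain ⟨hv, hξ⟩ := hVΩ _ hq
    have hS := (hZ v hv t₀ ht₀ ξ hξ).1
    exact ⟨hessXi_isSymm hsm hS.1.1 hS.1.2, GDhess_isSymm hMo hsm hS.1.1 hS.1.2⟩
  · intro x hx ξ hξ
    obtain ⟨hS, hv, ht, hξ', hZx⟩ := hin x hx ξ hξ
    simp only at hv ht hξ' hZx
    set v := gradXi n φ x ξ with hvdef
    have hZt : ∀ t ∈ T, DifferentiableAt ℝ (fun t => Z ((v, t), ξ)) t := fun t ht =>
      ((hZ v hv t ht ξ hξ').2.1.differentiableAt (by simp)).comp t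
        (f := fun t => ((v, t), ξ)) (by fun_prop)
    have key := hessXi_sub_eq_of_curve hsm hB hS.1.2 a b (y := fun t => Z ((v, t), ξ)) hT hTc hZt
      (fun t ht => (hZ v hv t ht ξ hξ').1.1.1) (fun t ht => (hZ v hv t ht ξ hξ').1.2.2)
      (fun t ht => ?_) ht ht₀
    · simp only [hZx] at key
      exact sub_eq_iff_eq_add'.1 key
    · have hS' := (hZ v hv t ht ξ hξ').1.1
      refine hker _ hS'.1 ξ hS'.2 _ ?_
      have hcomp := ((smoothOnProd_gradXi hsm).differentiableAt_left hS'.1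
        hS'.2).hasFDerivAt.comp_hasDerivAt t (hZt t ht).hasDerivAt
      refine hcomp.unique ((hasDerivAt_const t v).congr_of_eventuallyEq ?_)
      filter_upwards [hT.mem_nhds ht] with s hs
      exact (hZ v hv s hs ξ hξ').2.2
  · intro v ξ hq
    obtain ⟨hv, hξ⟩ := hVΩ _ hq
    have hS := (hZ v hv t₀ ht₀ ξ hξ).1
    exact hdet _ hS.1.1 _ hS.1.2
  · intro x hx ξ hξ
    obtain ⟨hS, hv, -, hξ', -⟩ := hin x hx ξ hξ
    simp only at hv hξ'
    have hu := (smoothOnProd_gradXi hsm).differentiableAt_left hS.1.1 hS.1.2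
    have hG0 : fderiv ℝ (fun y => gradXi n φ y ξ) x (gaussMap n φ x ξ) = 0 := by
      rw [fderiv_gradXi_apply hu, mixedHess_transpose_mulVec_gaussMap hn]
    have hfib : ∀ f : (Fin (n-1) → ℝ) → ℝ, DifferentiableAt ℝ f (gradXi n φ x ξ) →
        DifferentiableAt ℝ (fun y => f (gradXi n φ y ξ)) x ∧
        fderiv ℝ (fun y => f (gradXi n φ y ξ)) x (gaussMap n φ x ξ) = 0 := by
      intro f hf
      have h := hf.hasFDerivAt.comp x hu.hasFDerivAt
      have h' : HasFDerivAt (fun y => f (gradXi n φ y ξ)) _ x := h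
      refine ⟨h'.differentiableAt, ?_⟩
      rw [h'.fderiv, ContinuousLinearMap.comp_apply]
      exact (congrArg _ hG0).trans (map_zero _)
    obtain ⟨hAd, hA0⟩ := hfib _ ((hAs a b).differentiableAt_left hv hξ')
    obtain ⟨hBd, hB0⟩ := hfib _ ((hBs a b).differentiableAt_left hv hξ')
    have hh : DifferentiableAt ℝ (fun y => hessXi n φ y ξ a b) x :=
      (smoothOnProd_hessXi hsm a b).differentiableAt_left hS.1.1 hS.1.2
    change fderiv ℝ (fun y => (hessXi n φ y ξ a b - A (gradXi n φ y ξ) ξ a b) /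
      B (gradXi n φ y ξ) ξ a b) x (gaussMap n φ x ξ) ≠ 0
    rw [fderiv_fun_div_apply (hh.fun_sub hAd) hBd (hBab _ hv ξ hξ'), hB0,
      fderiv_fun_sub hh hAd, sub_apply, hA0, mul_zero, sub_zero, sub_zero]
    exact div_ne_zero (mul_ne_zero hS.2.2 (hBab _ hv ξ hξ')) (pow_ne_zero 2 (hBab _ hv ξ hξ'))
  · intro hpos v ξ hq
    obtain ⟨hv, hξ⟩ := hVΩ _ hq
    have hS := (hZ v hv t₀ ht₀ ξ hξ).1
    exact hpos _ hS.1.1 _ hS.1.2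
end

section
/- Fix n ≥ 3. There exist connected open neighborhoods M of the point (0,0,1) ∈ ℝ^{n−2} × ℝ × ℝ and Σ of 0 ∈ ℝ^{n−1} such that φ_{n,tan}, restricted to M × Σ, is a positive-definite Hörmander-type phase function (it satisfies (H1) and (H2+)) and satisfies Bourgain's condition. -/
open Metric Set Topology MeasureTheory

noncomputable section

/-- The tan-example phase function in ℝⁿ with n = m+3.  Coordinates:
x = (x′, x_{n-1}, t) with x′ = (x 0, …, x m), x_{n-1} = x (m+1), t = x (m+2);
ξ = (ξ′, ξ_{n-1}) with ξ′ = (ξ 0, …, ξ m), ξ_{n-1} = ξ (m+1).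
φ(x,ξ) = x′·ξ′ + ½ t² |ξ′|² + log (sec (t ξ_{n-1} + x_{n-1})). -/
def φtan (m : ℕ) (x : Fin (m+3) → ℝ) (ξ : Fin (m+2) → ℝ) : ℝ :=
  (∑ i : Fin (m+1), x (Fin.castLE (by omega) i) * ξ (Fin.castLE (by omega) i))
  + (1/2) * (x ⟨m+2, by omega⟩)^2 * (∑ i : Fin (m+1), (ξ (Fin.castLE (by omega) i))^2)
  + Real.log ((Real.cos (x ⟨m+2, by omega⟩ * ξ ⟨m+1, by omega⟩ + x ⟨m+1, by omega⟩))⁻¹)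

/-- The argument `t ξ_{n-1} + x_{n-1}` of the secant in the tan-example phase. -/
def tanArg (m : ℕ) (x : Fin (m+3) → ℝ) (ξ : Fin (m+2) → ℝ) : ℝ :=
  x ⟨m+2, by omega⟩ * ξ ⟨m+1, by omega⟩ + x ⟨m+1, by omega⟩

lemma hasFDerivAt_coord {k : ℕ} (i : Fin k) (x : Fin k → ℝ) :
    HasFDerivAt (fun y : Fin k → ℝ => y i) (ContinuousLinearMap.proj (R := ℝ) (φ := fun _ => ℝ) i) x :=
  hasFDerivAt_apply i x

lemma hasFDerivAt_tanArg_right (m : ℕ) (x : Fin (m+3) → ℝ) (ξ : Fin (m+2) → ℝ) :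
    HasFDerivAt (tanArg m x) (x ⟨m+2, by omega⟩ •
      (ContinuousLinearMap.proj (R := ℝ) (φ := fun _ => ℝ) (⟨m+1, by omega⟩ : Fin (m+2)))) ξ :=
  ((hasFDerivAt_coord _ ξ).const_mul _).add_const _

lemma hasFDerivAt_tanArg_left (m : ℕ) (x : Fin (m+3) → ℝ) (ξ : Fin (m+2) → ℝ) :
    HasFDerivAt (fun y => tanArg m y ξ) (ξ ⟨m+1, by omega⟩ •
      (ContinuousLinearMap.proj (R := ℝ) (φ := fun _ => ℝ) (⟨m+2, by omega⟩ : Fin (m+3))) +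
      ContinuousLinearMap.proj (R := ℝ) (φ := fun _ => ℝ) (⟨m+1, by omega⟩ : Fin (m+3))) x :=
  ((hasFDerivAt_coord _ x).mul_const _).add (hasFDerivAt_coord _ x)

lemma eventually_cos_right {m : ℕ} {x : Fin (m+3) → ℝ} {ξ : Fin (m+2) → ℝ}
    (h : Real.cos (tanArg m x ξ) ≠ 0) : ∀ᶠ η in 𝓝 ξ, Real.cos (tanArg m x η) ≠ 0 :=
  (Real.continuous_cos.continuousAt.comp
    (hasFDerivAt_tanArg_right m x ξ).continuousAt).eventually_ne h

lemma eventually_cos_left {m : ℕ} {x : Fin (m+3) → ℝ} {ξ : Fin (m+2) → ℝ}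
    (h : Real.cos (tanArg m x ξ) ≠ 0) : ∀ᶠ y in 𝓝 x, Real.cos (tanArg m y ξ) ≠ 0 :=
  (Real.continuous_cos.continuousAt.comp
    (hasFDerivAt_tanArg_left m x ξ).continuousAt).eventually_ne h

lemma hasDerivAt_log_sec {u : ℝ} (h : Real.cos u ≠ 0) :
    HasDerivAt (fun v => Real.log (Real.cos v)⁻¹) (Real.tan u) u := by
  have := ((Real.hasDerivAt_cos u).log h).neg
  simp only [Real.log_inv]
  rwa [neg_div, neg_neg, ← Real.tan_eq_sin_div_cos] at this

lemma hasFDerivAt_φtan {m : ℕ} {x : Fin (m+3) → ℝ} {ξ : Fin (m+2) → ℝ}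
    (h : Real.cos (tanArg m x ξ) ≠ 0) :
    ∃ L : (Fin (m+2) → ℝ) →L[ℝ] ℝ, HasFDerivAt (φtan m x) L ξ ∧ ∀ v, L v =
      ∑ i : Fin (m+1), (x (Fin.castLE (by omega) i) +
        (x ⟨m+2, by omega⟩)^2 * ξ (Fin.castLE (by omega) i)) * v (Fin.castLE (by omega) i)
      + x ⟨m+2, by omega⟩ * Real.tan (tanArg m x ξ) * v ⟨m+1, by omega⟩ := by
  have h1 := HasFDerivAt.fun_sum (u := Finset.univ) fun (i : Fin (m+1)) _ =>
    (hasFDerivAt_coord (Fin.castLE (by omega) i : Fin (m+2)) ξ).const_mul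
      (x (Fin.castLE (by omega) i))
  have h2 := (HasFDerivAt.fun_sum (u := Finset.univ) fun (i : Fin (m+1)) _ =>
    (hasFDerivAt_coord (Fin.castLE (by omega) i : Fin (m+2)) ξ).pow 2).const_mul
      ((1/2) * (x ⟨m+2, by omega⟩)^2)
  have h3 := (hasDerivAt_log_sec h).comp_hasFDerivAt ξ (hasFDerivAt_tanArg_right m x ξ)
  refine ⟨_, (h1.add h2).add h3, fun v => ?_⟩
  simp [Finset.mul_sum, add_mul, Finset.sum_add_distrib]
  congr 1
  · congr 1
    refine Finset.sum_congr rfl fun i _ => ?_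
    ring
  · ring

lemma gradXi_φtan_castSucc {m : ℕ} {x : Fin (m+3) → ℝ} {ξ : Fin (m+2) → ℝ}
    (h : Real.cos (tanArg m x ξ) ≠ 0) (j : Fin (m+1)) :
    gradXi (m+3) (φtan m) x ξ j.castSucc =
      x j.castSucc.castSucc + (x (Fin.last _))^2 * ξ j.castSucc := by
  obtain ⟨L, hL, hv⟩ := hasFDerivAt_φtan h
  refine (congrArg (fun A => A (Pi.single j.castSucc (1:ℝ))) hL.fderiv).trans ?_
  refine (hv _).trans ?_
  rw [Finset.sum_eq_single j]
  · have : (⟨m+1, by omega⟩ : Fin (m+2)) ≠ j.castSucc := by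
      simp [Fin.ext_iff]; omega
    rw [Pi.single_eq_of_ne this]
    have : (Fin.castLE (by omega) j : Fin (m+2)) = j.castSucc := rfl
    simp [this]
    rfl
  · intro b _ hb
    have : (Fin.castLE (by omega) b : Fin (m+2)) ≠ j.castSucc := by
      simpa [Fin.ext_iff] using hb
    rw [Pi.single_eq_of_ne this, mul_zero]
  · simp

lemma gradXi_φtan_last {m : ℕ} {x : Fin (m+3) → ℝ} {ξ : Fin (m+2) → ℝ}
    (h : Real.cos (tanArg m x ξ) ≠ 0) :
    gradXi (m+3) (φtan m) x ξ (Fin.last (m+1)) =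
      x (Fin.last _) * Real.tan (tanArg m x ξ) := by
  obtain ⟨L, hL, hv⟩ := hasFDerivAt_φtan h
  refine (congrArg (fun A => A (Pi.single (Fin.last (m+1)) (1:ℝ))) hL.fderiv).trans ?_
  refine (hv _).trans ?_
  rw [Finset.sum_eq_zero]
  · have : (⟨m+1, by omega⟩ : Fin (m+2)) = Fin.last (m+1) := rfl
    simp [this]
    left; rfl
  · intro b _
    have : (Fin.castLE (by omega) b : Fin (m+2)) ≠ Fin.last (m+1) := by
      simp [Fin.ext_iff]; omega
    rw [Pi.single_eq_of_ne this, mul_zero]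

lemma hessXi_φtan {m : ℕ} {x : Fin (m+3) → ℝ} {ξ : Fin (m+2) → ℝ}
    (h : Real.cos (tanArg m x ξ) ≠ 0) (i j : Fin (m+2)) :
    hessXi (m+3) (φtan m) x ξ i j = if i = j then
      (if i = Fin.last (m+1) then x (Fin.last _) ^ 2 / Real.cos (tanArg m x ξ) ^ 2
        else x (Fin.last _) ^ 2) else 0 := by
  simp only [hessXi, Matrix.of_apply]
  induction i using Fin.lastCases with
  | last =>
    have he : (fun η => gradXi (m+3) (φtan m) x η (Fin.last (m+1))) =ᶠ[𝓝 ξ]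
        fun η => x (Fin.last _) * Real.tan (tanArg m x η) :=
      (eventually_cos_right h).mono fun η hη => gradXi_φtan_last hη
    have hd := (((Real.hasDerivAt_tan h).comp_hasFDerivAt ξ
      (hasFDerivAt_tanArg_right m x ξ)).const_mul (x (Fin.last _))).congr_of_eventuallyEq he
    refine (congrArg (fun A => A (Pi.single j (1:ℝ))) hd.fderiv).trans ?_
    have e1 : (⟨m+1, by omega⟩ : Fin (m+2)) = Fin.last (m+1) := rfl
    have e2 : (⟨m+2, by omega⟩ : Fin (m+3)) = Fin.last (m+2) := rfl
    simp [e1, e2, Pi.single_apply]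
    congr 1
    ring
  | cast i =>
    have he : (fun η => gradXi (m+3) (φtan m) x η i.castSucc) =ᶠ[𝓝 ξ]
        fun η => x i.castSucc.castSucc + (x (Fin.last _))^2 * η i.castSucc :=
      (eventually_cos_right h).mono fun η hη => gradXi_φtan_castSucc hη i
    have hd := (((hasFDerivAt_coord i.castSucc ξ).const_mul (x (Fin.last _) ^ 2)).const_add
      (x i.castSucc.castSucc)).congr_of_eventuallyEq he
    refine (congrArg (fun A => A (Pi.single j (1:ℝ))) hd.fderiv).trans ?_
    have e1 : i.castSucc ≠ Fin.last (m+1) := (Fin.castSucc_lt_last i).ne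
    simp [e1, Pi.single_apply]

lemma mixedHess_φtan_castSucc {m : ℕ} {x : Fin (m+3) → ℝ} {ξ : Fin (m+2) → ℝ}
    (h : Real.cos (tanArg m x ξ) ≠ 0) (i : Fin (m+3)) (j : Fin (m+1)) :
    mixedHess (m+3) (φtan m) x ξ i j.castSucc =
      (if i = j.castSucc.castSucc then 1 else 0) +
      (if i = Fin.last _ then 2 * x (Fin.last _) * ξ j.castSucc else 0) := by
  simp only [mixedHess, Matrix.of_apply]
  have he : (fun y => gradXi (m+3) (φtan m) y ξ j.castSucc) =ᶠ[𝓝 x]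
      fun y => y j.castSucc.castSucc + (y (Fin.last _))^2 * ξ j.castSucc :=
    (eventually_cos_left h).mono fun η hη => gradXi_φtan_castSucc hη j
  have hd := ((hasFDerivAt_coord j.castSucc.castSucc x).add
    (((hasFDerivAt_coord (Fin.last _) x).pow 2).mul_const (ξ j.castSucc))).congr_of_eventuallyEq he
  refine (congrArg (fun A => A (Pi.single i (1:ℝ))) hd.fderiv).trans ?_
  simp [Pi.single_apply, eq_comm (a := i)]
  congr 1
  ring

lemma mixedHess_φtan_last {m : ℕ} {x : Fin (m+3) → ℝ} {ξ : Fin (m+2) → ℝ}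
    (h : Real.cos (tanArg m x ξ) ≠ 0) (i : Fin (m+3)) :
    mixedHess (m+3) (φtan m) x ξ i (Fin.last (m+1)) =
      (if i = (Fin.last (m+1)).castSucc then x (Fin.last _) / Real.cos (tanArg m x ξ) ^ 2 else 0) +
      (if i = Fin.last _ then Real.tan (tanArg m x ξ) +
        x (Fin.last _) * ξ (Fin.last _) / Real.cos (tanArg m x ξ) ^ 2 else 0) := by
  simp only [mixedHess, Matrix.of_apply]
  have he : (fun y => gradXi (m+3) (φtan m) y ξ (Fin.last (m+1))) =ᶠ[𝓝 x]
      fun y => y (Fin.last _) * Real.tan (tanArg m y ξ) :=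
    (eventually_cos_left h).mono fun η hη => gradXi_φtan_last hη
  have hd := ((hasFDerivAt_coord (Fin.last _) x).mul ((Real.hasDerivAt_tan h).comp_hasFDerivAt x
    (hasFDerivAt_tanArg_left m x ξ))).congr_of_eventuallyEq he
  refine (congrArg (fun A => A (Pi.single i (1:ℝ))) hd.fderiv).trans ?_
  have e1 : (⟨m+1, by omega⟩ : Fin (m+3)) = (Fin.last (m+1)).castSucc := rfl
  have e2 : (⟨m+2, by omega⟩ : Fin (m+3)) = Fin.last (m+2) := rfl
  have e3 : (⟨m+1, by omega⟩ : Fin (m+2)) = Fin.last (m+1) := rfl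
  simp [Pi.single_apply, eq_comm (a := i), e1, e2, e3]
  split_ifs <;> ring

/-- A square matrix whose first `k` columns have identity upper block and whose last two columns
vanish in the upper block has the determinant of its lower right `2 × 2` block. -/
lemma det_of_identity_block {k : ℕ} (A : Matrix (Fin (k+2)) (Fin (k+2)) ℝ)
    (h1 : ∀ a b : Fin k, A (Fin.castAdd 2 a) (Fin.castAdd 2 b) = if a = b then 1 else 0)
    (h2 : ∀ (a : Fin k) (b : Fin 2), A (Fin.castAdd 2 a) (Fin.natAdd k b) = 0) :
    A.det = A (Fin.natAdd k 0) (Fin.natAdd k 0) * A (Fin.natAdd k 1) (Fin.natAdd k 1) -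
      A (Fin.natAdd k 0) (Fin.natAdd k 1) * A (Fin.natAdd k 1) (Fin.natAdd k 0) := by
  rw [← Matrix.det_submatrix_equiv_self finSumFinEquiv A,
    ← Matrix.fromBlocks_toBlocks (A.submatrix finSumFinEquiv finSumFinEquiv)]
  have e12 : (A.submatrix finSumFinEquiv finSumFinEquiv).toBlocks₁₂ = 0 := by
    ext a b
    simpa [Matrix.toBlocks₁₂] using h2 a b
  have e11 : (A.submatrix finSumFinEquiv finSumFinEquiv).toBlocks₁₁ = 1 := by
    ext a b
    simpa [Matrix.toBlocks₁₁, Matrix.one_apply] using h1 a b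
  rw [e12, e11, Matrix.det_fromBlocks_zero₁₂, Matrix.det_one, one_mul, Matrix.det_fin_two]
  simp [Matrix.toBlocks₂₂]

lemma gaussMap_φtan {m : ℕ} {x : Fin (m+3) → ℝ} {ξ : Fin (m+2) → ℝ}
    (h : Real.cos (tanArg m x ξ) ≠ 0) :
    gaussMap (m+3) (φtan m) x ξ (Fin.last (m+2)) =
        x (Fin.last _) / Real.cos (tanArg m x ξ) ^ 2 ∧
    gaussMap (m+3) (φtan m) x ξ (Fin.last (m+1)).castSucc =
        - (Real.tan (tanArg m x ξ) +
          x (Fin.last _) * ξ (Fin.last _) / Real.cos (tanArg m x ξ) ^ 2) := by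
  have key : ∀ i : Fin (m+3), (∀ a : Fin (m+1), i ≠ a.castSucc.castSucc) →
      gaussMap (m+3) (φtan m) x ξ i =
        x (Fin.last _) / Real.cos (tanArg m x ξ) ^ 2 *
          (Pi.single i (1:ℝ) : Fin (m+3) → ℝ) (Fin.last (m+2)) -
        (Pi.single i (1:ℝ) : Fin (m+3) → ℝ) (Fin.last (m+1)).castSucc *
          (Real.tan (tanArg m x ξ) +
          x (Fin.last _) * ξ (Fin.last _) / Real.cos (tanArg m x ξ) ^ 2) := by
    intro i hi
    have p0 : (Fin.natAdd (m+1) 0 : Fin (m+1+2)) = (Fin.last (m+1)).castSucc := rfl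
    have p1 : (Fin.natAdd (m+1) 1 : Fin (m+1+2)) = Fin.last (m+2) := rfl
    have pc : ∀ a : Fin (m+1), (Fin.castAdd 2 a : Fin (m+1+2)) = a.castSucc.castSucc :=
      fun _ => rfl
    have ne0 : ∀ a : Fin (m+1), a.castSucc.castSucc ≠ (Fin.last (m+1)).castSucc := by
      intro a; simp [Fin.ext_iff]; omega
    have ne1 : ∀ a : Fin (m+2), a.castSucc ≠ Fin.last (m+2) :=
      fun a => (Fin.castSucc_lt_last a).ne
    set A : Matrix (Fin (m+3)) (Fin (m+3)) ℝ := Matrix.of fun a b : Fin (m+3) =>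
      if h : (b : ℕ) < m+3 - 1 then mixedHess (m+3) (φtan m) x ξ a ⟨(b : ℕ), h⟩
      else (Pi.single i (1:ℝ) : Fin (m+3) → ℝ) a with hA
    have c1 : ∀ a (b : Fin (m+1)), A a b.castSucc.castSucc =
        mixedHess (m+3) (φtan m) x ξ a b.castSucc := by
      intro a b
      have : (b : ℕ) < m+3-1 := by omega
      simp only [hA, Matrix.of_apply, Fin.val_castSucc]
      rw [dif_pos this]; rfl
    have c2 : ∀ a, A a (Fin.last (m+1)).castSucc =
        mixedHess (m+3) (φtan m) x ξ a (Fin.last (m+1)) := by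
      intro a
      have : m+1 < m+3-1 := by omega
      simp only [hA, Matrix.of_apply, Fin.val_castSucc, Fin.val_last]
      rw [dif_pos this]; rfl
    have c3 : ∀ a, A a (Fin.last (m+2)) = (Pi.single i (1:ℝ) : Fin (m+3) → ℝ) a := by
      intro a
      simp [hA]
    change A.det = _
    refine (det_of_identity_block (k := m+1) A ?_ ?_).trans ?_
    · intro a b
      rw [pc, pc, c1, mixedHess_φtan_castSucc h, if_neg (ne1 _)]
      simp
    · intro a b
      fin_cases b
      · rw [pc]
        refine (c2 _).trans ?_
        rw [mixedHess_φtan_last h, if_neg (ne1 _), if_neg (ne0 _), add_zero]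
      · rw [pc]
        refine (c3 _).trans ?_
        exact Pi.single_eq_of_ne (hi a).symm _
    · rw [p0, p1, c2, c2, c3, c3, mixedHess_φtan_last h, mixedHess_φtan_last h,
        if_neg (ne1 _), if_neg (ne1 _).symm]
      simp
  constructor
  · rw [key _ fun a => (Fin.castSucc_lt_last _).ne']
    rw [Pi.single_eq_same, Pi.single_eq_of_ne (Fin.castSucc_lt_last _).ne]
    ring
  · rw [key]
    · rw [Pi.single_eq_same, Pi.single_eq_of_ne (Fin.castSucc_lt_last _).ne']
      ring
    · intro a; simp [Fin.ext_iff]; omega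

lemma GD_sq {m : ℕ} {x : Fin (m+3) → ℝ} {ξ : Fin (m+2) → ℝ}
    (h : Real.cos (tanArg m x ξ) ≠ 0) :
    GD (m+3) (φtan m) (fun y => y (Fin.last _) ^ 2) ξ x =
      2 * x (Fin.last _) ^ 2 / Real.cos (tanArg m x ξ) ^ 2 := by
  refine (congrArg (fun A => A (gaussMap (m+3) (φtan m) x ξ))
    ((hasFDerivAt_coord (Fin.last _) x).pow 2).fderiv).trans ?_
  simp [(gaussMap_φtan h).1]
  ring

lemma GD_sq_mul_sec_sq {m : ℕ} {x : Fin (m+3) → ℝ} {ξ : Fin (m+2) → ℝ}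
    (h : Real.cos (tanArg m x ξ) ≠ 0) (c : ℝ) :
    GD (m+3) (φtan m) (fun y => c * (y (Fin.last _) ^ 2 / Real.cos (tanArg m y ξ) ^ 2)) ξ x =
      c * (2 * x (Fin.last _) ^ 2 / Real.cos (tanArg m x ξ) ^ 2) := by
  have hd := (((hasFDerivAt_coord (Fin.last _) x).pow 2).mul
    (((((Real.hasDerivAt_cos (tanArg m x ξ)).fun_pow 2).fun_inv (pow_ne_zero 2 h))).comp_hasFDerivAt x
    (hasFDerivAt_tanArg_left m x ξ))).const_mul c
  refine (congrArg (fun A => A (gaussMap (m+3) (φtan m) x ξ)) hd.fderiv).trans ?_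
  have e1 : (⟨m+1, by omega⟩ : Fin (m+3)) = (Fin.last (m+1)).castSucc := rfl
  have e2 : (⟨m+2, by omega⟩ : Fin (m+3)) = Fin.last (m+2) := rfl
  have e3 : (⟨m+1, by omega⟩ : Fin (m+2)) = Fin.last (m+1) := rfl
  simp [e1, e2, e3, (gaussMap_φtan h).1, (gaussMap_φtan h).2, Real.tan_eq_sin_div_cos]
  have hs := Real.sin_sq_add_cos_sq (tanArg m x ξ)
  set s := Real.sin (tanArg m x ξ)
  set k := Real.cos (tanArg m x ξ)
  field_simp
  linear_combination (-(c * x (Fin.last (m+2)) ^ 2 * k)) * hs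

lemma GDhess_φtan {m : ℕ} {x : Fin (m+3) → ℝ} {ξ : Fin (m+2) → ℝ}
    (h : Real.cos (tanArg m x ξ) ≠ 0) (i j : Fin (m+2)) :
    GDhess (m+3) (φtan m) x ξ i j = if i = j then
      2 * (x (Fin.last _) ^ 2 / Real.cos (tanArg m x ξ) ^ 2) else 0 := by
  have congr : ∀ f : (Fin (m+3) → ℝ) → ℝ,
      (fun y => hessXi (m+3) (φtan m) y ξ i j) =ᶠ[𝓝 x] f →
      GDhess (m+3) (φtan m) x ξ i j = GD (m+3) (φtan m) f ξ x := fun f hf =>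
    congrArg (fun A : (Fin (m+3) → ℝ) →L[ℝ] ℝ => A (gaussMap (m+3) (φtan m) x ξ)) hf.fderiv_eq
  have hc := eventually_cos_left h
  by_cases hij : i = j
  · rw [if_pos hij]
    by_cases hi : i = Fin.last (m+1)
    · rw [congr (fun y => 1 * (y (Fin.last _) ^ 2 / Real.cos (tanArg m y ξ) ^ 2))
        (hc.mono fun y hy => by simp only [hessXi_φtan hy, if_pos hij, if_pos hi, one_mul]),
        GD_sq_mul_sec_sq h]
      ring
    · rw [congr (fun y => y (Fin.last _) ^ 2)
        (hc.mono fun y hy => by simp only [hessXi_φtan hy, if_pos hij, if_neg hi]), GD_sq h]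
      ring
  · rw [if_neg hij, congr (fun _ => 0)
      (hc.mono fun y hy => by simp only [hessXi_φtan hy, if_neg hij])]
    simp [GD]

lemma GD2hess_φtan {m : ℕ} {x : Fin (m+3) → ℝ} {ξ : Fin (m+2) → ℝ}
    (h : Real.cos (tanArg m x ξ) ≠ 0) :
    GD2hess (m+3) (φtan m) x ξ = (2 : ℝ) • GDhess (m+3) (φtan m) x ξ := by
  ext i j
  have congr : ∀ f : (Fin (m+3) → ℝ) → ℝ,
      (fun y => GDhess (m+3) (φtan m) y ξ i j) =ᶠ[𝓝 x] f →
      GD2hess (m+3) (φtan m) x ξ i j = GD (m+3) (φtan m) f ξ x := fun f hf =>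
    congrArg (fun A : (Fin (m+3) → ℝ) →L[ℝ] ℝ => A (gaussMap (m+3) (φtan m) x ξ)) hf.fderiv_eq
  have hc := eventually_cos_left h
  rw [Matrix.smul_apply, GDhess_φtan h]
  by_cases hij : i = j
  · rw [if_pos hij, congr (fun y => 2 * (y (Fin.last _) ^ 2 / Real.cos (tanArg m y ξ) ^ 2))
      (hc.mono fun y hy => by simp only [GDhess_φtan hy, if_pos hij]), GD_sq_mul_sec_sq h,
      smul_eq_mul]
    ring
  · rw [if_neg hij, congr (fun _ => 0)
      (hc.mono fun y hy => by simp only [GDhess_φtan hy, if_neg hij])]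
    simp [GD]

lemma posDef_GDhess_φtan {m : ℕ} {x : Fin (m+3) → ℝ} {ξ : Fin (m+2) → ℝ}
    (h : Real.cos (tanArg m x ξ) ≠ 0) (ht : x (Fin.last _) ≠ 0) :
    (GDhess (m+3) (φtan m) x ξ).PosDef := by
  have : GDhess (m+3) (φtan m) x ξ = Matrix.diagonal fun _ : Fin (m+2) =>
      2 * (x (Fin.last _) ^ 2 / Real.cos (tanArg m x ξ) ^ 2) := by
    ext i j
    rw [Matrix.diagonal_apply]
    exact GDhess_φtan h i j
  rw [this]
  exact Matrix.PosDef.diagonal fun _ => by positivity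

lemma rank_mixedHess_φtan {m : ℕ} {x : Fin (m+3) → ℝ} {ξ : Fin (m+2) → ℝ}
    (h : Real.cos (tanArg m x ξ) ≠ 0) (ht : x (Fin.last _) ≠ 0) :
    (mixedHess (m+3) (φtan m) x ξ).rank = m+2 := by
  refine le_antisymm (by simpa using Matrix.rank_le_width (mixedHess (m+3) (φtan m) x ξ)) ?_
  have hD : (mixedHess (m+3) (φtan m) x ξ).submatrix (Fin.castSucc : Fin (m+2) → Fin (m+3))
      (id : Fin (m+2) → Fin (m+2)) = Matrix.diagonal (fun j : Fin (m+2) =>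
        if j = Fin.last _ then x (Fin.last _) / Real.cos (tanArg m x ξ) ^ 2 else 1) := by
    ext i j
    refine (Matrix.submatrix_apply ..).trans ?_
    have hi : i.castSucc ≠ Fin.last (m+2) := (Fin.castSucc_lt_last i).ne
    rw [Matrix.diagonal_apply]
    induction j using Fin.lastCases with
    | last =>
      refine (mixedHess_φtan_last h _).trans ?_
      simp only [if_neg hi, Fin.castSucc_inj, add_zero]
      split_ifs <;> rfl
    | cast j =>
      refine (mixedHess_φtan_castSucc h _ j).trans ?_
      have hj : j.castSucc ≠ Fin.last (m+1) := (Fin.castSucc_lt_last j).ne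
      simp only [if_neg hi, Fin.castSucc_inj, add_zero]
      split_ifs with h1 h2
      · exact absurd (h1 ▸ h2) hj
      · rfl
      · rfl
  have hr := Matrix.rank_submatrix_le (mixedHess (m+3) (φtan m) x ξ)
    (Fin.castSucc : Fin (m+2) → Fin (m+3)) (id : Fin (m+2) → Fin (m+2))
  rw [hD, Matrix.rank_of_isUnit] at hr
  · simpa using hr
  · rw [Matrix.isUnit_iff_isUnit_det, Matrix.det_diagonal, isUnit_iff_ne_zero,
      Finset.prod_ne_zero_iff]
    intro j _
    split_ifs
    · positivity
    · exact one_ne_zero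

lemma contDiffOn_φtan {m : ℕ} {S : Set ((Fin (m+3) → ℝ) × (Fin (m+2) → ℝ))}
    (hS : ∀ q ∈ S, Real.cos (tanArg m q.1 q.2) ≠ 0) :
    ContDiffOn ℝ (⊤ : ℕ∞)
      (fun q : (Fin (m+3) → ℝ) × (Fin (m+2) → ℝ) => φtan m q.1 q.2) S := by
  have hu : ContDiff ℝ (⊤ : ℕ∞)
      (fun q : (Fin (m+3) → ℝ) × (Fin (m+2) → ℝ) => tanArg m q.1 q.2) := by
    unfold tanArg; fun_prop
  refine ContDiffOn.add (ContDiff.contDiffOn ?_) ?_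
  · fun_prop
  · exact (((Real.contDiff_cos.comp hu).contDiffOn).inv hS).log fun q hq => inv_ne_zero (hS q hq)

theorem stmt11 (m : ℕ) :
    ∃ (M : Set (Fin (m+3) → ℝ)) (Ω : Set (Fin (m+2) → ℝ)),
      IsOpen M ∧ IsConnected M ∧ IsOpen Ω ∧ IsConnected Ω ∧
      (fun i : Fin (m+3) => if (i : ℕ) = m+2 then (1:ℝ) else 0) ∈ M ∧
      (0 : Fin (m+2) → ℝ) ∈ Ω ∧
      (∀ x ∈ M, ∀ ξ ∈ Ω,
        x ⟨m+2, by omega⟩ * ξ ⟨m+1, by omega⟩ + x ⟨m+1, by omega⟩ ∈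
          Ioo (-(Real.pi/2)) (Real.pi/2)) ∧
      ContDiffOn ℝ (⊤ : ℕ∞)
        (fun q : (Fin (m+3) → ℝ) × (Fin (m+2) → ℝ) => φtan m q.1 q.2) (M ×ˢ Ω) ∧
      (∀ x ∈ M, ∀ ξ ∈ Ω, (mixedHess (m+3) (φtan m) x ξ).rank = m+2) ∧
      (∀ x ∈ M, ∀ ξ ∈ Ω, (GDhess (m+3) (φtan m) x ξ).PosDef) ∧
      BourgainCond (m+3) (φtan m) M Ω := by
  let M : Set (Fin (m+3) → ℝ) :=
    (fun x => x (Fin.last (m+2))) ⁻¹' Ioo (1/2) (3/2) ∩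
      (fun x => x (Fin.last (m+1)).castSucc) ⁻¹' Ioo (-1/2) (1/2)
  let Ω : Set (Fin (m+2) → ℝ) := (fun ξ => ξ (Fin.last (m+1))) ⁻¹' Ioo (-1/2) (1/2)
  have convex_coord : ∀ {k : ℕ} (i : Fin k) (a b : ℝ),
      Convex ℝ ((fun x : Fin k → ℝ => x i) ⁻¹' Ioo a b) := fun i a b =>
    (convex_Ioo a b).linear_preimage (LinearMap.proj (R := ℝ) (φ := fun _ => ℝ) i)
  have hpM : (fun i : Fin (m+3) => if (i : ℕ) = m+2 then (1:ℝ) else 0) ∈ M := by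
    constructor <;> simp <;> norm_num
  have h0 : (0 : Fin (m+2) → ℝ) ∈ Ω := by
    constructor <;> norm_num
  have harg : ∀ x ∈ M, ∀ ξ ∈ Ω, tanArg m x ξ ∈ Ioo (-(Real.pi/2)) (Real.pi/2) := by
    rintro x ⟨⟨h1, h2⟩, h3, h4⟩ ξ ⟨h5, h6⟩
    have hpi := Real.pi_gt_three
    have e : tanArg m x ξ = x (Fin.last (m+2)) * ξ (Fin.last (m+1)) +
      x (Fin.last (m+1)).castSucc := rfl
    rw [e]
    simp only at h1 h2 h3 h4 h5 h6
    constructor <;> nlinarith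
  have hcos : ∀ x ∈ M, ∀ ξ ∈ Ω, Real.cos (tanArg m x ξ) ≠ 0 := fun x hx ξ hξ =>
    (Real.cos_pos_of_mem_Ioo (harg x hx ξ hξ)).ne'
  have ht : ∀ x ∈ M, x (Fin.last (m+2)) ≠ 0 := fun x hx =>
    (lt_trans (by norm_num) hx.1.1).ne'
  exact ⟨M, Ω,
    (isOpen_Ioo.preimage (continuous_apply _)).inter (isOpen_Ioo.preimage (continuous_apply _)),
    ((convex_coord _ _ _).inter (convex_coord _ _ _)).isConnected ⟨_, hpM⟩,
    isOpen_Ioo.preimage (continuous_apply _),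
    (convex_coord _ _ _).isConnected ⟨_, h0⟩,
    hpM, h0, harg,
    contDiffOn_φtan fun q hq => hcos _ hq.1 _ hq.2,
    fun x hx ξ hξ => rank_mixedHess_φtan (hcos x hx ξ hξ) (ht x hx),
    fun x hx ξ hξ => posDef_GDhess_φtan (hcos x hx ξ hξ) (ht x hx),
    fun _ _ => 2, fun x hx ξ hξ => GD2hess_φtan (hcos x hx ξ hξ)⟩
end
end
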